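/- arXiv:1410.0390 — 5 statements merged into one kernel-verified Lean document; each statement's English description precedes it below -/
import Mathlib

section
/- Let f : ℝⁿ → ℝ be differentiable with L-Lipschitz gradient (L > 0), let D be a finite set of unit vectors in ℝⁿ, and let μ > 0 be such that for every nonzero v ∈ ℝⁿ there exists d ∈ D with ⟨v, d⟩ ≥ μ‖v‖. Let x ∈ ℝⁿ, α > 0 and c > 0. If f(x) − cα² < f(x + αd) for every d ∈ D, then ‖∇f(x)‖ ≤ (L/2 + c)·α/μ. -/
open scoped RealInnerProductSpace

/-- The descent lemma: a function with `L`-Lipschitz gradient lies below the quadratic model given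
by its first-order expansion and curvature `L`. -/
theorem le_add_inner_gradient_add_of_lipschitz_gradient {E : Type*} [NormedAddCommGroup E]
    [InnerProductSpace ℝ E] [CompleteSpace E] {f : E → ℝ} {L : ℝ} (hdiff : Differentiable ℝ f)
    (hlip : ∀ x y : E, ‖gradient f x - gradient f y‖ ≤ L * ‖x - y‖) (x v : E) :
    f (x + v) ≤ f x + ⟪gradient f x, v⟫ + L / 2 * ‖v‖ ^ 2 := by
  have hf (t : ℝ) : HasDerivAt (fun s : ℝ => f (x + s • v)) ⟪gradient f (x + t • v), v⟫ t := by
    have h := (hdiff (x + t • v)).hasGradientAt.hasFDerivAt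
    have hline : HasDerivAt (fun s : ℝ => x + s • v) v t := by
      simpa using ((hasDerivAt_id t).smul_const v).const_add x
    simpa [Function.comp_def] using h.comp_hasDerivAt t hline
  have hB (t : ℝ) : HasDerivAt
      (fun s : ℝ => f x + s * ⟪gradient f x, v⟫ + L / 2 * ‖v‖ ^ 2 * s ^ 2)
      (⟪gradient f x, v⟫ + L * ‖v‖ ^ 2 * t) t := by
    refine ((((hasDerivAt_id t).mul_const ⟪gradient f x, v⟫).const_add (f x)).add
      (((hasDerivAt_id t).pow 2).const_mul (L / 2 * ‖v‖ ^ 2))).congr_deriv ?_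
    simp only [id, Nat.cast_ofNat]
    ring
  have bound (t : ℝ) (ht : 0 ≤ t) :
      ⟪gradient f (x + t • v), v⟫ ≤ ⟪gradient f x, v⟫ + L * ‖v‖ ^ 2 * t := by
    rw [← sub_le_iff_le_add', ← inner_sub_left]
    calc ⟪gradient f (x + t • v) - gradient f x, v⟫
        ≤ ‖gradient f (x + t • v) - gradient f x‖ * ‖v‖ := real_inner_le_norm _ _
      _ ≤ L * ‖x + t • v - x‖ * ‖v‖ := by gcongr; exact hlip _ _
      _ = L * ‖v‖ ^ 2 * t := by
        rw [add_sub_cancel_left, norm_smul, Real.norm_of_nonneg ht]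
        ring
  simpa using image_le_of_deriv_right_le_deriv_boundary (a := 0) (b := 1)
    (fun t _ => (hf t).continuousAt.continuousWithinAt) (fun t _ => (hf t).hasDerivWithinAt)
    (by simp) (fun t _ => (hB t).continuousAt.continuousWithinAt)
    (fun t _ => (hB t).hasDerivWithinAt) (fun t ht => bound t ht.1)
    (Set.right_mem_Icc.2 zero_le_one)

theorem sds_key_lemma {n : ℕ} (f : EuclideanSpace ℝ (Fin n) → ℝ) (L : ℝ) (hL : 0 < L)
    (hdiff : Differentiable ℝ f)
    (hlip : ∀ x y : EuclideanSpace ℝ (Fin n), ‖gradient f x - gradient f y‖ ≤ L * ‖x - y‖)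
    (D : Finset (EuclideanSpace ℝ (Fin n))) (hDunit : ∀ d ∈ D, ‖d‖ = 1)
    (μ : ℝ) (hμ : 0 < μ)
    (hcos : ∀ v : EuclideanSpace ℝ (Fin n), v ≠ 0 → ∃ d ∈ D, μ * ‖v‖ ≤ ⟪v, d⟫)
    (x : EuclideanSpace ℝ (Fin n)) (α c : ℝ) (hα : 0 < α) (hc : 0 < c)
    (hfail : ∀ d ∈ D, f x - c * α ^ 2 < f (x + α • d)) :
    ‖gradient f x‖ ≤ (L / 2 + c) * α / μ := by
  by_cases hg : gradient f x = 0
  · rw [hg, norm_zero]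
    positivity
  obtain ⟨d, hd, hcosd⟩ := hcos (-gradient f x) (neg_ne_zero.2 hg)
  rw [norm_neg, inner_neg_left] at hcosd
  have hdescent := le_add_inner_gradient_add_of_lipschitz_gradient hdiff hlip x (α • d)
  rw [real_inner_smul_right, norm_smul, hDunit d hd, Real.norm_of_nonneg hα.le,
    mul_one] at hdescent
  have hdec := hfail d hd
  rw [le_div_iff₀ hμ]
  refine le_of_mul_le_mul_left ?_ hα
  have := mul_le_mul_of_nonneg_left hcosd hα.le
  linarith
end

section
/- Let n ≥ 1 and let D₊ = {±e₁, ..., ±eₙ} ⊂ ℝⁿ be the maximal positive basis consisting of the standard coordinate vectors and their negatives. Then the cosine measure of D₊ equals 1/√n; that is, (a) for every nonzero v ∈ ℝⁿ there exists d ∈ D₊ with ⟨v, d⟩ ≥ ‖v‖/√n, and (b) there exists a nonzero v ∈ ℝⁿ (e.g., v = (1,1,...,1)) such that ⟨v, d⟩ ≤ ‖v‖/√n for all d ∈ D₊. -/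
open scoped RealInnerProductSpace

/-- Some coordinate of a vector of `ℝⁿ`, `n ≥ 1`, is at least `‖v‖ / √n` in absolute value. -/
theorem EuclideanSpace.exists_norm_div_sqrt_le_abs {n : ℕ} (hn : 1 ≤ n)
    (v : EuclideanSpace ℝ (Fin n)) : ∃ i, ‖v‖ / Real.sqrt n ≤ |v i| := by
  have hn' : (0 : ℝ) < n := by exact_mod_cast hn
  have : Nonempty (Fin n) := ⟨⟨0, hn⟩⟩
  obtain ⟨i, -, hi⟩ := Finset.exists_le_of_sum_le (s := Finset.univ)
    (f := fun _ : Fin n => ‖v‖ ^ 2 / n) (g := fun i => v i ^ 2) Finset.univ_nonempty (by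
      rw [Finset.sum_const, Finset.card_univ, Fintype.card_fin, nsmul_eq_mul,
        mul_div_cancel₀ _ hn'.ne', EuclideanSpace.real_norm_sq_eq])
  refine ⟨i, abs_le_of_sq_le_sq' ?_ (abs_nonneg _) |>.2⟩
  rwa [div_pow, Real.sq_sqrt hn'.le, sq_abs]

theorem cosine_measure_maximal_positive_basis {n : ℕ} (hn : 1 ≤ n)
    (Dplus : Set (EuclideanSpace ℝ (Fin n)))
    (hDplus : Dplus = {d | ∃ i : Fin n,
      d = EuclideanSpace.single i (1 : ℝ) ∨ d = -EuclideanSpace.single i (1 : ℝ)}) :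
    (∀ v : EuclideanSpace ℝ (Fin n), v ≠ 0 →
      ∃ d ∈ Dplus, ‖v‖ / Real.sqrt n ≤ ⟪v, d⟫) ∧
    (∃ v : EuclideanSpace ℝ (Fin n), v ≠ 0 ∧
      ∀ d ∈ Dplus, ⟪v, d⟫ ≤ ‖v‖ / Real.sqrt n) := by
  subst hDplus
  have hn' : (0 : ℝ) < n := by exact_mod_cast hn
  constructor
  · intro v _
    obtain ⟨i, hi⟩ := EuclideanSpace.exists_norm_div_sqrt_le_abs hn v
    rcases le_total 0 (v i) with h | h
    · refine ⟨_, ⟨i, Or.inl rfl⟩, ?_⟩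
      rw [abs_of_nonneg h] at hi
      simpa [EuclideanSpace.inner_single_right] using hi
    · refine ⟨_, ⟨i, Or.inr rfl⟩, ?_⟩
      rw [abs_of_nonpos h] at hi
      simpa [EuclideanSpace.inner_single_right] using hi
  · have hnorm : ‖(WithLp.toLp 2 fun _ => 1 : EuclideanSpace ℝ (Fin n))‖ = Real.sqrt n := by
      simp [EuclideanSpace.norm_eq]
    refine ⟨WithLp.toLp 2 fun _ => 1, ?_, ?_⟩
    · rw [← norm_pos_iff, hnorm]
      exact Real.sqrt_pos.2 hn'
    · rw [hnorm, div_self (Real.sqrt_pos.2 hn').ne']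
      rintro d ⟨i, rfl | rfl⟩
      · simp [EuclideanSpace.inner_single_right]
      · rw [inner_neg_right, EuclideanSpace.inner_single_right]
        norm_num
end

section
/- Let f : ℝⁿ → ℝ be convex, let x₀ ∈ ℝⁿ, let d ∈ ℝⁿ, let c > 0, and let 0 < α ≤ α₀. If f(x₀ + α d) > f(x₀) − cα², then f(x₀ + α₀ d) > f(x₀) − cα₀². -/
theorem unsuccessful_step_persists_convex {n : ℕ} (f : EuclideanSpace ℝ (Fin n) → ℝ)
    (hconv : ConvexOn ℝ Set.univ f)
    (x₀ d : EuclideanSpace ℝ (Fin n)) (c α α₀ : ℝ)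
    (hc : 0 < c) (hα : 0 < α) (hαα₀ : α ≤ α₀)
    (hfail : f (x₀ + α • d) > f x₀ - c * α ^ 2) :
    f (x₀ + α₀ • d) > f x₀ - c * α₀ ^ 2 := by
  have hα₀ : 0 < α₀ := hα.trans_le hαα₀
  have hne : α₀ ≠ 0 := hα₀.ne'
  have hpoint : (1 - α / α₀) • x₀ + (α / α₀) • (x₀ + α₀ • d) = x₀ + α • d := by
    rw [smul_add, smul_smul, div_mul_cancel₀ α hne, ← add_assoc, ← add_smul,
      sub_add_cancel, one_smul]
  have hle := hconv.2 (Set.mem_univ x₀) (Set.mem_univ (x₀ + α₀ • d))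
    (sub_nonneg.2 ((div_le_one hα₀).2 hαα₀)) (div_pos hα hα₀).le (sub_add_cancel 1 (α / α₀))
  rw [hpoint, smul_eq_mul, smul_eq_mul] at hle
  have hdiff : α / α₀ * (-(c * α * α₀)) < α / α₀ * (f (x₀ + α₀ • d) - f x₀) := by
    have hsq : α / α₀ * (-(c * α * α₀)) = -(c * α ^ 2) := by field_simp
    linarith
  have hlt := lt_of_mul_lt_mul_left hdiff (div_pos hα hα₀).le
  have hmono : c * α * α₀ ≤ c * α₀ ^ 2 := by
    rw [pow_two, ← mul_assoc]
    gcongr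
  linarith
end

section
/- Let f : ℝⁿ → ℝ be differentiable with L-Lipschitz gradient (L > 0), let D be a finite set of unit vectors in ℝⁿ, and let μ > 0 be such that for every nonzero v ∈ ℝⁿ there exists d ∈ D with ⟨v, d⟩ ≥ μ‖v‖. Let c > 0, α₀ > 0, and suppose x_k ∈ ℝⁿ and α_k = α₀/2^k satisfy f(x_k + α_k d) > f(x_k) − cα_k² for all d ∈ D. Then ‖∇f(x_k)‖ ≤ (L/2 + c)α₀/(μ·2^k). In particular, for any ε with 0 < ε < (L/2 + c)α₀/μ, if k ≥ ⌈log₂((L/2 + c)α₀/(με))⌉ then ‖∇f(x_k)‖ ≤ ε. -/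
open scoped RealInnerProductSpace

/-- The descent lemma for functions with Lipschitz gradient. -/
theorem le_add_inner_gradient_add_sq {F : Type*} [NormedAddCommGroup F]
    [InnerProductSpace ℝ F] [CompleteSpace F] {f : F → ℝ} {L : ℝ} (hdiff : Differentiable ℝ f)
    (hlip : ∀ x y : F, ‖gradient f x - gradient f y‖ ≤ L * ‖x - y‖) (x v : F) :
    f (x + v) ≤ f x + ⟪gradient f x, v⟫ + L / 2 * ‖v‖ ^ 2 := by
  have hφ (t : ℝ) : HasDerivAt (fun t : ℝ => f (x + t • v)) ⟪gradient f (x + t • v), v⟫ t := by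
    have h : HasDerivAt (fun t : ℝ => x + t • v) v t := by
      simpa using ((hasDerivAt_id t).smul_const v).const_add x
    exact (hdiff (x + t • v)).hasGradientAt.hasFDerivAt.comp_hasDerivAt t h
  have hB (t : ℝ) : HasDerivAt
      (fun t : ℝ => f x + t * ⟪gradient f x, v⟫ + L / 2 * ‖v‖ ^ 2 * t ^ 2)
      (⟪gradient f x, v⟫ + L * t * ‖v‖ ^ 2) t := by
    have h := (((hasDerivAt_id t).mul_const ⟪gradient f x, v⟫).const_add (f x)).add
      ((hasDerivAt_pow 2 t).const_mul (L / 2 * ‖v‖ ^ 2))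
    exact h.congr_deriv (by norm_num; ring)
  have hbound (t : ℝ) (ht : t ∈ Set.Ico (0 : ℝ) 1) :
      ⟪gradient f (x + t • v), v⟫ ≤ ⟪gradient f x, v⟫ + L * t * ‖v‖ ^ 2 := by
    have hg : ‖gradient f (x + t • v) - gradient f x‖ ≤ L * (t * ‖v‖) := by
      simpa [norm_smul, abs_of_nonneg ht.1] using hlip (x + t • v) x
    have hin := (real_inner_le_norm (gradient f (x + t • v) - gradient f x) v).trans
      (mul_le_mul_of_nonneg_right hg (norm_nonneg v))
    rw [inner_sub_left] at hin
    linarith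
  have key := image_le_of_deriv_right_le_deriv_boundary (a := 0) (b := 1)
    (fun t _ => (hφ t).continuousAt.continuousWithinAt)
    (fun t _ => (hφ t).hasDerivWithinAt) (by simp)
    (fun t _ => (hB t).continuousAt.continuousWithinAt)
    (fun t _ => (hB t).hasDerivWithinAt) hbound (Set.right_mem_Icc.2 zero_le_one)
  simpa using key

theorem sds_nonconvex_gradient_bound {n : ℕ} (f : EuclideanSpace ℝ (Fin n) → ℝ)
    (L : ℝ) (hL : 0 < L) (hdiff : Differentiable ℝ f)
    (hlip : ∀ x y : EuclideanSpace ℝ (Fin n), ‖gradient f x - gradient f y‖ ≤ L * ‖x - y‖)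
    (D : Finset (EuclideanSpace ℝ (Fin n))) (hDunit : ∀ d ∈ D, ‖d‖ = 1)
    (μ : ℝ) (hμ : 0 < μ)
    (hcos : ∀ v : EuclideanSpace ℝ (Fin n), v ≠ 0 → ∃ d ∈ D, μ * ‖v‖ ≤ ⟪v, d⟫)
    (c α₀ : ℝ) (hc : 0 < c) (hα₀ : 0 < α₀)
    (k : ℕ) (xk : EuclideanSpace ℝ (Fin n)) (αk : ℝ) (hαk : αk = α₀ / 2 ^ k)
    (hfail : ∀ d ∈ D, f (xk + αk • d) > f xk - c * αk ^ 2) :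
    ‖gradient f xk‖ ≤ (L / 2 + c) * α₀ / (μ * 2 ^ k) ∧
    ∀ ε : ℝ, 0 < ε → ε < (L / 2 + c) * α₀ / μ →
      (⌈Real.logb 2 ((L / 2 + c) * α₀ / (μ * ε))⌉ : ℝ) ≤ (k : ℝ) →
      ‖gradient f xk‖ ≤ ε := by
  have hpow : (0 : ℝ) < 2 ^ k := by positivity
  have hα : 0 < αk := hαk ▸ div_pos hα₀ hpow
  have hmain : ‖gradient f xk‖ ≤ (L / 2 + c) * α₀ / (μ * 2 ^ k) := by
    by_cases hg : gradient f xk = 0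
    · rw [hg, norm_zero]
      positivity
    obtain ⟨d, hd, hμd⟩ := hcos (-gradient f xk) (neg_ne_zero.2 hg)
    rw [norm_neg, inner_neg_left] at hμd
    have hdesc := le_add_inner_gradient_add_sq hdiff hlip xk (αk • d)
    rw [inner_smul_right, norm_smul, hDunit d hd, mul_one, Real.norm_eq_abs, sq_abs] at hdesc
    have hlower := hfail d hd
    have hscaled : αk * (μ * ‖gradient f xk‖) ≤ αk * ((L / 2 + c) * αk) := by
      nlinarith [mul_le_mul_of_nonneg_left hμd hα.le]
    have hle := le_of_mul_le_mul_left hscaled hα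
    rw [hαk, ← mul_div_assoc, le_div_iff₀ hpow] at hle
    rw [le_div_iff₀ (by positivity)]
    linarith
  refine ⟨hmain, fun ε hε _ hk => hmain.trans ?_⟩
  have hlog := (Int.le_ceil _).trans hk
  rw [Real.logb_le_iff_le_rpow one_lt_two (by positivity), Real.rpow_natCast,
    div_le_iff₀ (by positivity)] at hlog
  rw [div_le_iff₀ (by positivity)]
  linarith
end

section
/- Let f : ℝⁿ → ℝ be λ-strongly convex (λ > 0) and differentiable with L-Lipschitz gradient (L > 0), with minimizer x* ∈ ℝⁿ. Let D be a finite set of unit vectors in ℝⁿ and μ > 0 be such that for every nonzero v ∈ ℝⁿ there exists d ∈ D with ⟨v, d⟩ ≥ μ‖v‖. Let c > 0, α > 0, x ∈ ℝⁿ. If f(x + αd) > f(x) − cα² for all d ∈ D, then f(x) − f(x*) ≤ (L/2 + c)²α²/(2λμ²). -/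
open scoped RealInnerProductSpace

section

variable {E : Type*} [NormedAddCommGroup E] [InnerProductSpace ℝ E] [CompleteSpace E]

/-- The descent lemma: a function with `L`-Lipschitz gradient lies below its quadratic upper
model. -/
theorem le_add_inner_gradient_add_sq_of_lipschitz_gradient {f : E → ℝ} {L : ℝ}
    (hdiff : Differentiable ℝ f)
    (hlip : ∀ x y : E, ‖gradient f x - gradient f y‖ ≤ L * ‖x - y‖) (x u : E) :
    f (x + u) ≤ f x + ⟪gradient f x, u⟫ + L / 2 * ‖u‖ ^ 2 := by
  have hline (t : ℝ) : HasDerivAt (fun t : ℝ => f (x + t • u)) ⟪gradient f (x + t • u), u⟫ t := by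
    have hinner : HasDerivAt (fun t : ℝ => x + t • u) u t := by
      simpa using ((hasDerivAt_id t).smul_const u).const_add x
    simpa [Function.comp_def] using
      (hdiff (x + t • u)).hasGradientAt.hasFDerivAt.comp_hasDerivAt t hinner
  have hmodel (t : ℝ) :
      HasDerivAt (fun t : ℝ => f x + t * ⟪gradient f x, u⟫ + L / 2 * ‖u‖ ^ 2 * t ^ 2)
        (⟪gradient f x, u⟫ + L * ‖u‖ ^ 2 * t) t := by
    refine ((((hasDerivAt_id t).mul_const ⟪gradient f x, u⟫).const_add (f x)).add
      ((hasDerivAt_pow 2 t).const_mul (L / 2 * ‖u‖ ^ 2))).congr_deriv ?_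
    norm_num
    ring
  have hbound (t : ℝ) (ht : t ∈ Set.Ico (0 : ℝ) 1) :
      ⟪gradient f (x + t • u), u⟫ ≤ ⟪gradient f x, u⟫ + L * ‖u‖ ^ 2 * t := by
    have hcs := real_inner_le_norm (gradient f (x + t • u) - gradient f x) u
    have hgrad := hlip (x + t • u) x
    rw [add_sub_cancel_left, norm_smul, Real.norm_of_nonneg ht.1] at hgrad
    rw [inner_sub_left] at hcs
    nlinarith [mul_le_mul_of_nonneg_right hgrad (norm_nonneg u)]
  have key := image_le_of_deriv_right_le_deriv_boundary
    (fun t _ => (hline t).continuousAt.continuousWithinAt)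
    (fun t _ => (hline t).hasDerivWithinAt) (by simp)
    (fun t _ => (hmodel t).continuousAt.continuousWithinAt)
    (fun t _ => (hmodel t).hasDerivWithinAt) hbound (Set.right_mem_Icc.2 zero_le_one)
  simpa using key

end

/-- A strong convexity inequality between two points bounds the gap in function value by the
squared norm of the subgradient (Polyak–Łojasiewicz). -/
theorem sub_le_norm_sq_div_of_strong_convexity_inequality {E : Type*} [NormedAddCommGroup E]
    [InnerProductSpace ℝ E] {a b m : ℝ} (hm : 0 < m) (g u : E)
    (h : a + ⟪g, u⟫ + m / 2 * ‖u‖ ^ 2 ≤ b) : a - b ≤ ‖g‖ ^ 2 / (2 * m) := by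
  have hcs := (abs_le.1 (abs_real_inner_le_norm g u)).1
  rw [le_div_iff₀ (by positivity)]
  nlinarith [sq_nonneg (‖g‖ - m * ‖u‖)]

theorem sds_strongly_convex_function_value_bound {n : ℕ}
    (f : EuclideanSpace ℝ (Fin n) → ℝ)
    (L : ℝ) (hL : 0 < L) (hdiff : Differentiable ℝ f)
    (hlip : ∀ x y : EuclideanSpace ℝ (Fin n), ‖gradient f x - gradient f y‖ ≤ L * ‖x - y‖)
    (lam : ℝ) (hlam : 0 < lam)
    (hsc : ∀ x y : EuclideanSpace ℝ (Fin n),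
      f x + ⟪gradient f x, y - x⟫ + lam / 2 * ‖y - x‖ ^ 2 ≤ f y)
    (xstar : EuclideanSpace ℝ (Fin n)) (hmin : ∀ y, f xstar ≤ f y)
    (D : Finset (EuclideanSpace ℝ (Fin n))) (hDunit : ∀ d ∈ D, ‖d‖ = 1)
    (μ : ℝ) (hμ : 0 < μ)
    (hcos : ∀ v : EuclideanSpace ℝ (Fin n), v ≠ 0 → ∃ d ∈ D, μ * ‖v‖ ≤ ⟪v, d⟫)
    (c α : ℝ) (hc : 0 < c) (hα : 0 < α)
    (x : EuclideanSpace ℝ (Fin n))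
    (hfail : ∀ d ∈ D, f (x + α • d) > f x - c * α ^ 2) :
    f x - f xstar ≤ (L / 2 + c) ^ 2 * α ^ 2 / (2 * lam * μ ^ 2) := by
  have hgrad : μ * ‖gradient f x‖ ≤ (L / 2 + c) * α := by
    rcases eq_or_ne (gradient f x) 0 with hzero | hne
    · rw [hzero, norm_zero, mul_zero]
      positivity
    · obtain ⟨d, hd, hcosd⟩ := hcos (-gradient f x) (neg_ne_zero.2 hne)
      have hdescent :=
        le_add_inner_gradient_add_sq_of_lipschitz_gradient hdiff hlip x (α • d)
      have hunsucc := hfail d hd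
      rw [norm_neg, inner_neg_left] at hcosd
      rw [real_inner_smul_right, norm_smul, hDunit d hd, Real.norm_of_nonneg hα.le] at hdescent
      refine le_of_mul_le_mul_left ?_ hα
      nlinarith [mul_le_mul_of_nonneg_left hcosd hα.le]
  refine (sub_le_norm_sq_div_of_strong_convexity_inequality hlam _ _ (hsc x xstar)).trans ?_
  rw [div_le_div_iff₀ (by positivity) (by positivity)]
  have hsq := pow_le_pow_left₀ (by positivity) hgrad 2
  nlinarith [mul_le_mul_of_nonneg_left hsq (by positivity : 0 ≤ 2 * lam)]
end
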